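/- arXiv:1812.00765 — 5 statements merged into one kernel-verified Lean document; each statement's English description precedes it below -/
import Mathlib

section
/- Let a ≠ 0 and b₆ ≠ 0, b₇ be real constants, let f(x) = b₆ x + b₇ for x ∈ ℝ, let J be an open interval, and let g : J → ℝ be twice continuously differentiable such that Ω(x,v) = 0 for all (x,v) ∈ ℝ × J. Then g'(v) = 0 for all v ∈ J, i.e. g is constant. -/
/-- The quantity `Ω` whose vanishing characterizes minimality of the affine
factorable surface of the second kind `φ(x,z) = (x, f(x)g(z+ax), z)` in the
pseudo-Galilean space `G₃¹`. -/
noncomputable def OmegaPG (a : ℝ) (f f' f'' g g' g'' : ℝ → ℝ) (x v : ℝ) : ℝ :=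
  (1 - a ^ 2) * f x * g'' v - f'' x * g v - 2 * a * f' x * g' v
    + (f x) ^ 2 * f'' x * (g' v) ^ 2 * g v
    + 2 * a * f' x * (f x) ^ 2 * (g' v) ^ 3
    + a ^ 2 * (f x) ^ 3 * (g' v) ^ 2 * g'' v

/-- Case (3) of Theorem 4.2 (minimal affine factorable surfaces of the second
kind in `G₃¹`, rigorous form): if `f x = b₆ x + b₇` is affine nonconstant
(so `f' = b₆ ≠ 0`, `f'' = 0`, and `f` takes all real values) and `Ω = 0` for
all `(x,v) ∈ ℝ × J`, then `g' ≡ 0` on `J`, i.e. `g` is constant. -/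
theorem affine_factorable_minimal_case_f_affine
    (a b₆ b₇ r s : ℝ) (ha : a ≠ 0) (hb₆ : b₆ ≠ 0) (g g' g'' : ℝ → ℝ)
    (hg : ∀ v ∈ Set.Ioo r s, HasDerivAt g (g' v) v)
    (hg' : ∀ v ∈ Set.Ioo r s, HasDerivAt g' (g'' v) v)
    (hg'' : ContinuousOn g'' (Set.Ioo r s))
    (heq : ∀ x : ℝ, ∀ v ∈ Set.Ioo r s,
      OmegaPG a (fun t => b₆ * t + b₇) (fun _ => b₆) (fun _ => 0)
        g g' g'' x v = 0) :
    (∀ v ∈ Set.Ioo r s, g' v = 0) ∧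
    ∃ c : ℝ, ∀ v ∈ Set.Ioo r s, g v = c := by
  have hzero : ∀ v ∈ Set.Ioo r s, g' v = 0 := by
    intro v hv
    have hroot : b₆ * (-b₇ / b₆) + b₇ = 0 := by
      field_simp
      ring
    have h := heq (-b₇ / b₆) v hv
    simp only [OmegaPG, hroot] at h
    have h_mul : (a * b₆) * g' v = 0 := by linear_combination (-1 / 2) * h
    exact (mul_eq_zero.mp h_mul).resolve_left (mul_ne_zero ha hb₆)
  refine ⟨hzero, isOpen_Ioo.exists_is_const_of_deriv_eq_zero isPreconnected_Ioo
    (fun v hv => (hg v hv).differentiableAt.differentiableWithinAt) fun v hv => ?_⟩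
  rw [(hg v hv).deriv, hzero v hv, Pi.zero_apply]
end

section
/- Let a ≠ 0 and b₁₁ ≠ 0, b₁₂ be real constants, let g(v) = b₁₁ v + b₁₂ for v ∈ ℝ, let I be an open interval, and let f : I → ℝ be twice continuously differentiable such that Ω(x,v) = 0 for all (x,v) ∈ I × ℝ. Then f'(x) = 0 for all x ∈ I, i.e. f is constant. -/
/-- If `Ω(x, ·)` vanishes at the zero of the affine function `g`, then
`f'(x) (b₁₁² f(x)² - 1) = 0`. -/
theorem mul_sq_sub_one_eq_zero_of_omegaPG_affine {a b₁₁ b₁₂ x : ℝ} {f f' f'' : ℝ → ℝ}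
    (ha : a ≠ 0) (hb₁₁ : b₁₁ ≠ 0)
    (h : ∀ v : ℝ, OmegaPG a f f' f'' (fun t => b₁₁ * t + b₁₂) (fun _ => b₁₁)
      (fun _ => 0) x v = 0) :
    f' x * (b₁₁ ^ 2 * f x ^ 2 - 1) = 0 := by
  have hroot : b₁₁ * (-b₁₂ / b₁₁) + b₁₂ = 0 := by field_simp; ring
  have hΩ := h (-b₁₂ / b₁₁)
  simp only [OmegaPG, hroot] at hΩ
  have hne : 2 * a * b₁₁ ≠ 0 := by positivity
  refine (mul_eq_zero.mp ?_).resolve_left hne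
  linear_combination hΩ

/-- If `f' (b² f² - 1)` vanishes near `x` and `f'` is continuous at `x`, then `f'(x) = 0`. -/
theorem deriv_eq_zero_of_mul_sq_sub_one_eventually_eq_zero {f f' : ℝ → ℝ} {x : ℝ} (b : ℝ)
    (hf : HasDerivAt f (f' x) x) (hf' : ContinuousAt f' x)
    (h : ∀ᶠ y in nhds x, f' y * (b ^ 2 * f y ^ 2 - 1) = 0) : f' x = 0 := by
  by_contra hne
  have hloc : (fun y => b ^ 2 * f y ^ 2 - 1) =ᶠ[nhds x] fun _ => 0 := by
    filter_upwards [h, hf'.eventually_ne hne] with y hy hy'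
    exact (mul_eq_zero.mp hy).resolve_left hy'
  have hval : b ^ 2 * f x ^ 2 - 1 = 0 := hloc.eq_of_nhds
  have hder := (((hf.pow 2).const_mul (b ^ 2)).sub_const 1).unique
    ((hasDerivAt_const x (0 : ℝ)).congr_of_eventuallyEq hloc)
  norm_num at hder
  rcases hder with hb | hfx | hfx
  · simp [hb] at hval
  · simp [hfx] at hval
  · exact hne hfx

/-- Case (4) of Theorem 4.2 (minimal affine factorable surfaces of the second
kind in `G₃¹`, rigorous form): if `g v = b₁₁ v + b₁₂` is affine nonconstant
(so `g' = b₁₁ ≠ 0`, `g'' = 0`, and `g` takes all real values) and `Ω = 0` for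
all `(x,v) ∈ I × ℝ`, then `f' ≡ 0` on `I`, i.e. `f` is constant. -/
theorem affine_factorable_minimal_case_g_affine
    (a b₁₁ b₁₂ p q : ℝ) (ha : a ≠ 0) (hb₁₁ : b₁₁ ≠ 0) (f f' f'' : ℝ → ℝ)
    (hf : ∀ x ∈ Set.Ioo p q, HasDerivAt f (f' x) x)
    (hf' : ∀ x ∈ Set.Ioo p q, HasDerivAt f' (f'' x) x)
    (hf'' : ContinuousOn f'' (Set.Ioo p q))
    (heq : ∀ x ∈ Set.Ioo p q, ∀ v : ℝ,
      OmegaPG a f f' f'' (fun t => b₁₁ * t + b₁₂) (fun _ => b₁₁)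
        (fun _ => 0) x v = 0) :
    (∀ x ∈ Set.Ioo p q, f' x = 0) ∧
    ∃ c : ℝ, ∀ x ∈ Set.Ioo p q, f x = c := by
  have hderiv : ∀ x ∈ Set.Ioo p q, f' x = 0 := by
    intro x hx
    refine deriv_eq_zero_of_mul_sq_sub_one_eventually_eq_zero b₁₁ (hf x hx)
      (hf' x hx).continuousAt ?_
    filter_upwards [isOpen_Ioo.mem_nhds hx] with y hy
    exact mul_sq_sub_one_eq_zero_of_omegaPG_affine ha hb₁₁ (heq y hy)
  refine ⟨hderiv, ?_⟩
  refine isOpen_Ioo.exists_is_const_of_deriv_eq_zero isPreconnected_Ioo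
    (fun x hx => (hf x hx).differentiableAt.differentiableWithinAt) ?_
  intro x hx
  rw [(hf x hx).deriv, hderiv x hx, Pi.zero_apply]
end

section
/- Let f₀ ≠ 0 and c be real constants and f(x) = f₀ x + c for x ∈ ℝ. Let J be an open interval, g : J → ℝ differentiable, and K₀ ∈ ℝ a constant such that K₀ (1 − f(x)² g'(v)²)² = f₀² g'(v)² for all (x,v) ∈ ℝ × J. Then K₀ = 0. -/
/-- Case 1 of the proof of Theorem 5.1: for the affine factorable surface of
the second kind with `f x = f₀ x + c` affine nonconstant (`f'' = 0`), the
constant-Gaussian-curvature condition `K₀ (1 - f² g'²)² = f₀² g'²` holding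
for all `x ∈ ℝ` and `v` in a nonempty open interval `J` forces `K₀ = 0`. -/
theorem affine_factorable_constant_K_f_affine_contradiction
    (f₀ c K₀ r s : ℝ) (hf₀ : f₀ ≠ 0) (hrs : r < s) (g : ℝ → ℝ)
    (hg : ∀ v ∈ Set.Ioo r s, DifferentiableAt ℝ g v)
    (heq : ∀ x : ℝ, ∀ v ∈ Set.Ioo r s,
      K₀ * (1 - (f₀ * x + c) ^ 2 * (deriv g v) ^ 2) ^ 2
        = f₀ ^ 2 * (deriv g v) ^ 2) :
    K₀ = 0 := by
  obtain ⟨v, hv⟩ := exists_between hrs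
  have hK : K₀ = f₀ ^ 2 * deriv g v ^ 2 := by
    have h := heq (-c / f₀) v hv
    rw [mul_div_cancel₀ _ hf₀] at h
    simpa using h
  by_cases hp : deriv g v = 0
  · simpa [hp] using hK
  · have h := heq (((deriv g v)⁻¹ - c) / f₀) v hv
    rw [mul_div_cancel₀ _ hf₀, sub_add_cancel, ← mul_pow, inv_mul_cancel₀ hp] at h
    rw [hK, ← h]
    ring
end

section
/- Let g₀ ≠ 0, K₀ > 0 and c be real constants, and define f(x) = (1/g₀) tanh(√K₀ x + c) for x ∈ ℝ. Then g₀² f(x)² < 1 and f'(x)² g₀² = K₀ (1 − g₀² f(x)²)² for all x ∈ ℝ; consequently the affine factorable surface y(x,z) = (g₀(z+ax) + λ₂)·(1/g₀) tanh(√K₀ x + c) has constant Gaussian curvature K₀. -/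
theorem Real.hasDerivAt_tanh (u : ℝ) :
    HasDerivAt Real.tanh (1 - Real.tanh u ^ 2) u := by
  have hcosh : Real.cosh u ≠ 0 := (Real.cosh_pos u).ne'
  have h := (Real.hasDerivAt_sinh u).div (Real.hasDerivAt_cosh u) hcosh
  have htanh : Real.tanh = Real.sinh / Real.cosh := by
    funext y
    exact Real.tanh_eq_sinh_div_cosh y
  rw [htanh]
  refine h.congr_deriv ?_
  rw [Pi.div_apply]
  field_simp

/-- Converse direction of Theorem 5.1 (as in Example 6.1(3)): for
`f x = (1/g₀) tanh(√K₀ x + c)` with `g₀ ≠ 0`, `K₀ > 0`, one has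
`g₀² f² < 1` and `f'² g₀² = K₀ (1 - g₀² f²)²` everywhere; consequently the
affine factorable surface `y(x,z) = (g₀(z+ax) + λ₂) ⋅ f(x)`, i.e. the one
with `g v = g₀ v + λ₂`, has Gaussian curvature
`K = (f'²g'² - f f'' g g'')/(1-(f g')²)²` identically equal to `K₀`. -/
theorem affine_factorable_tanh_has_constant_K
    (g₀ K₀ c : ℝ) (hg₀ : g₀ ≠ 0) (hK₀ : K₀ > 0) (f : ℝ → ℝ)
    (hfdef : f = fun x => (1 / g₀) * Real.tanh (Real.sqrt K₀ * x + c)) :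
    (∀ x : ℝ, g₀ ^ 2 * (f x) ^ 2 < 1) ∧
    (∀ x : ℝ, (deriv f x) ^ 2 * g₀ ^ 2 = K₀ * (1 - g₀ ^ 2 * (f x) ^ 2) ^ 2) ∧
    (∀ a lam₂ x z : ℝ, ∀ g : ℝ → ℝ, (g = fun v => g₀ * v + lam₂) →
      ((deriv f x) ^ 2 * (deriv g (z + a * x)) ^ 2
          - f x * deriv (deriv f) x
            * (g (z + a * x) * deriv (deriv g) (z + a * x))) /
        (1 - (f x * deriv g (z + a * x)) ^ 2) ^ 2 = K₀) := by
  have hf (x : ℝ) : g₀ * f x = Real.tanh (Real.sqrt K₀ * x + c) := by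
    rw [hfdef]
    field_simp
  have hderiv (x : ℝ) : deriv f x * g₀ =
      Real.sqrt K₀ * (1 - Real.tanh (Real.sqrt K₀ * x + c) ^ 2) := by
    have hlin : HasDerivAt (fun y : ℝ => Real.sqrt K₀ * y + c) (Real.sqrt K₀) x := by
      simpa using ((hasDerivAt_id x).const_mul (Real.sqrt K₀)).add_const c
    have h := ((Real.hasDerivAt_tanh (Real.sqrt K₀ * x + c)).comp x hlin).const_mul
      (1 / g₀)
    have hd : deriv f x = 1 / g₀ *
        ((1 - Real.tanh (Real.sqrt K₀ * x + c) ^ 2) * Real.sqrt K₀) := by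
      rw [hfdef]
      exact h.deriv
    rw [hd]
    field_simp
  have hbound (x : ℝ) : g₀ ^ 2 * f x ^ 2 < 1 := by
    rw [← mul_pow, hf]
    exact Real.tanh_sq_lt_one _
  have hode (x : ℝ) : deriv f x ^ 2 * g₀ ^ 2 = K₀ * (1 - g₀ ^ 2 * f x ^ 2) ^ 2 := by
    rw [← mul_pow, ← mul_pow, hderiv, hf, mul_pow, Real.sq_sqrt hK₀.le]
  refine ⟨hbound, hode, ?_⟩
  rintro a lam₂ x z g rfl
  have hg : deriv (fun v : ℝ => g₀ * v + lam₂) = fun _ => g₀ := by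
    funext v
    simp
  have hne : (1 - (f x * g₀) ^ 2) ^ 2 ≠ 0 := by
    have := hbound x
    exact pow_ne_zero 2 (by nlinarith)
  simp only [hg, deriv_const, mul_zero, sub_zero]
  rw [div_eq_iff hne, hode]
  ring
end

section
/- Let a ∈ ℝ, f₀ ≠ 0 and H₀ be real constants, and let g : ℝ → ℝ be twice differentiable with g'' constant (g''(v) = λ₃ for all v), with f₀² g'(v)² < 1 for all v ∈ ℝ, and satisfying 2H₀ (1 − f₀² g'(v)²)^{3/2} = f₀ g''(v) ((1−a²) + a² f₀² g'(v)²) for all v ∈ ℝ. Then λ₃ = 0 and H₀ = 0. -/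
/-- A function with constant derivative is affine. -/
theorem eq_add_mul_of_hasDerivAt_const {h : ℝ → ℝ} {c : ℝ} (hh : ∀ v, HasDerivAt h c v) (v : ℝ) :
    h v = h 0 + c * v := by
  have hd : ∀ x, HasDerivAt (fun x => h x - c * x) 0 x := fun x => by
    simpa using (hh x).fun_sub ((hasDerivAt_id' x).const_mul c)
  have := is_const_of_deriv_eq_zero (fun x => (hd x).differentiableAt) (fun x => (hd x).deriv) v 0
  simp only [mul_zero, sub_zero] at this
  linarith


/-- Rigorous resolution of Case (a) of Theorem 5.2 (affine factorable surfaces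
of the second kind in `G₃¹` with constant mean curvature `H₀`, `f ≡ f₀`
constant, `g'' ≡ λ₃` constant): if the constant-mean-curvature equation
`2H₀ (1 - f₀² g'²)^{3/2} = f₀ g'' ((1-a²) + a² f₀² g'²)` and the
nondegeneracy condition `f₀² g'² < 1` hold for all `v ∈ ℝ`, then `λ₃ = 0`
and `H₀ = 0`; so no such surface has nonzero constant mean curvature. -/
theorem affine_factorable_constant_H_f_const_contradiction
    (a f₀ H₀ lam₃ : ℝ) (hf₀ : f₀ ≠ 0) (g g' g'' : ℝ → ℝ)
    (hg : ∀ v : ℝ, HasDerivAt g (g' v) v)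
    (hg' : ∀ v : ℝ, HasDerivAt g' (g'' v) v)
    (hconst : ∀ v : ℝ, g'' v = lam₃)
    (hbound : ∀ v : ℝ, f₀ ^ 2 * (g' v) ^ 2 < 1)
    (heq : ∀ v : ℝ,
      2 * H₀ * (1 - f₀ ^ 2 * (g' v) ^ 2) ^ ((3 : ℝ) / 2)
        = f₀ * g'' v * ((1 - a ^ 2) + a ^ 2 * f₀ ^ 2 * (g' v) ^ 2)) :
    lam₃ = 0 ∧ H₀ = 0 := by
  have haff : ∀ v, g' v = g' 0 + lam₃ * v :=
    eq_add_mul_of_hasDerivAt_const fun v => hconst v ▸ hg' v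
  have hlam : lam₃ = 0 := by
    by_contra hne
    have hval : g' ((1 / f₀ - g' 0) / lam₃) = 1 / f₀ := by
      rw [haff]
      field_simp
      ring
    have hlt := hbound ((1 / f₀ - g' 0) / lam₃)
    rw [hval, ← mul_pow, mul_one_div_cancel hf₀] at hlt
    norm_num at hlt
  refine ⟨hlam, ?_⟩
  have hpos : 0 < (1 - f₀ ^ 2 * (g' 0) ^ 2) ^ ((3 : ℝ) / 2) :=
    Real.rpow_pos_of_pos (sub_pos.mpr (hbound 0)) _
  have h := heq 0
  rw [hconst, hlam, mul_zero, zero_mul] at h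
  simpa [hpos.ne'] using h
end
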